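/- The series ∑_{n=0}^∞ ((1/2)_n)^3/((1)_n^3) · (-1/8)^n equals π√6 / (3·Γ(7/12)²·Γ(11/12)²). -/

import Mathlib

open Real

noncomputable def poch (a : ℝ) (n : ℕ) : ℝ := (ascPochhammer ℝ n).eval a

/-- normalized Pochhammer symbol (a)_n / n! -/
noncomputable def pf (a : ℝ) (n : ℕ) : ℝ := poch a n / (n.factorial : ℝ)

lemma poch_zero (a : ℝ) : poch a 0 = 1 := by simp [poch]

lemma poch_succ (a : ℝ) (n : ℕ) : poch a (n+1) = poch a n * (a + n) := by
  simp [poch, ascPochhammer_succ_eval]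

lemma poch_one (n : ℕ) : poch 1 n = n.factorial := by
  simp [poch, ascPochhammer_eval_one]

lemma pf_zero (a : ℝ) : pf a 0 = 1 := by simp [pf, poch_zero]

lemma pf_succ (a : ℝ) (n : ℕ) : pf a (n+1) = pf a n * ((a + n) / (n + 1)) := by
  have : (n.factorial : ℝ) ≠ 0 := by positivity
  simp only [pf, poch_succ, Nat.factorial_succ]
  push_cast
  field_simp

lemma pf_nonneg {a : ℝ} (ha : 0 ≤ a) (n : ℕ) : 0 ≤ pf a n := by
  induction n with
  | zero => simp [pf_zero]
  | succ n ih => rw [pf_succ]; positivity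

lemma pf_le_one {a : ℝ} (ha : 0 ≤ a) (ha1 : a ≤ 1) (n : ℕ) : pf a n ≤ 1 := by
  induction n with
  | zero => simp [pf_zero]
  | succ n ih =>
    rw [pf_succ]
    have h2 : (a + n) / (n + 1) ≤ 1 := by
      rw [div_le_one (by positivity)]; linarith
    exact mul_le_one₀ ih (by positivity) h2

lemma pf_eq_choose (a : ℝ) (n : ℕ) : pf a n = Ring.choose (a + n - 1) n := by
  rw [← Ring.multichoose_eq]
  have h := Ring.factorial_nsmul_multichoose_eq_ascPochhammer a n
  rw [Polynomial.ascPochhammer_smeval_eq_eval, nsmul_eq_mul] at h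
  rw [pf, poch, ← h]
  have : (n.factorial : ℝ) ≠ 0 := by positivity
  field_simp

lemma pf_eq_choose' (a : ℝ) (n : ℕ) : (-1)^n * pf a n = Ring.choose (-a) n := by
  rw [Ring.choose_neg, pf_eq_choose]
  simp [Units.smul_def]

lemma pf_hasSum (a y : ℝ) (hy : |y| < 1) :
    HasSum (fun j => pf a j * y ^ j) ((1 - y) ^ (-a)) := by
  have h := (Real.one_div_one_sub_rpow_hasFPowerSeriesOnBall_zero a).hasSum (y := y)
    (by simpa [enorm_eq_nnnorm, ← NNReal.coe_lt_coe] using hy)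
  rw [show (0:ℝ) + y = y by ring] at h
  rw [Real.rpow_neg (by linarith [(abs_lt.mp hy).2]), ← one_div]
  have e : (fun j => pf a j * y ^ j) = fun n =>
      (FormalMultilinearSeries.ofScalars ℝ (fun n : ℕ => Ring.choose (a + n - 1) n) n) fun _ => y := by
    ext j
    simp [pf_eq_choose, mul_comm]
  rw [e]; exact h

/-- Clausen -/
lemma clausen (n : ℕ) :
    ∑ kl ∈ Finset.HasAntidiagonal.antidiagonal n, (pf (1/4) kl.1)^2 * (pf (1/4) kl.2)^2 = (pf (1/2) n)^3 := by
  open PowerSeries in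
  let f : PowerSeries ℝ := PowerSeries.mk (fun n => (pf (1/4) n)^2)
  let T : PowerSeries ℝ → PowerSeries ℝ := fun φ => X * d⁄dX ℝ φ
  have cT : ∀ φ n, coeff n (T φ) = n * coeff n φ := by
    intro φ n
    cases n with
    | zero => simp [T]
    | succ n => simp only [T, coeff_succ_X_mul, coeff_derivative]; push_cast; ring
  have Tadd : ∀ φ ψ, T (φ + ψ) = T φ + T ψ := by intro φ ψ; simp [T, mul_add]
  have Tmul : ∀ φ ψ, T (φ * ψ) = T φ * ψ + φ * T ψ := by
    intro φ ψ; simp only [T, Derivation.leibniz, smul_eq_mul]; ring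
  have TC : ∀ (r : ℝ) φ, T (C r * φ) = C r * T φ := by
    intro r φ; ext n; simp only [cT, coeff_C_mul]; ring
  have TX : T X = X := by simp [T]
  have ode : T (T f) = X * (T (T f) + C (1/2) * T f + C (1/16) * f) := by
    ext n
    cases n with
    | zero => simp [cT]
    | succ n =>
      simp only [coeff_succ_X_mul, map_add, cT, coeff_C_mul, f, coeff_mk, pf_succ]
      push_cast
      field_simp
      ring
  have ode3 : T (T (T f)) = X * (T (T f) + C (1/2) * T f + C (1/16) * f)
      + X * (T (T (T f)) + C (1/2) * T (T f) + C (1/16) * T f) := by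
    conv_lhs => rw [ode]
    rw [Tmul, TX, Tadd, Tadd, TC, TC]
  have key : T (T (T (f*f))) = X * (T (T (T (f*f))) + C (3/2) * T (T (f*f)) + C (3/4) * T (f * f)
      + C (1/8) * (f * f)) := by
    simp only [Tmul, Tadd]
    have e1 : (C (1/2) : PowerSeries ℝ) = 8 * C (1/16) := by
      rw [show (8 : PowerSeries ℝ) = C 8 from (map_ofNat C 8).symm, ← map_mul]; norm_num
    have e2 : (C (3/2) : PowerSeries ℝ) = 24 * C (1/16) := by
      rw [show (24 : PowerSeries ℝ) = C 24 from (map_ofNat C 24).symm, ← map_mul]; norm_num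
    have e3 : (C (3/4) : PowerSeries ℝ) = 12 * C (1/16) := by
      rw [show (12 : PowerSeries ℝ) = C 12 from (map_ofNat C 12).symm, ← map_mul]; norm_num
    have e4 : (C (1/8) : PowerSeries ℝ) = 2 * C (1/16) := by
      rw [show (2 : PowerSeries ℝ) = C 2 from (map_ofNat C 2).symm, ← map_mul]; norm_num
    have e5 : 16 * (C (1/16) : PowerSeries ℝ) = 1 := by
      rw [show (16 : PowerSeries ℝ) = C 16 from (map_ofNat C 16).symm, ← map_mul]; norm_num
    rw [e2, e3, e4]
    rw [e1] at ode ode3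
    generalize T (T (T f)) = f3 at *
    generalize T (T f) = f2 at *
    generalize T f = f1 at *
    generalize (C (1/16) : PowerSeries ℝ) = c at *
    linear_combination 6 * f1 * ode + 2 * f * ode3 + (-2 * f * f2 * X) * e5
  have hrec : ∀ n : ℕ, coeff n (f * f) = (pf (1/2) n)^3 := by
    intro n
    induction n with
    | zero => simp [f, coeff_mul, pf_zero]
    | succ n ih =>
      have h := congrArg (coeff (n+1)) key
      simp only [coeff_succ_X_mul, map_add, cT, coeff_C_mul] at h
      rw [ih] at h
      push_cast at h
      rw [pf_succ]
      have hn : (n:ℝ) + 1 ≠ 0 := by positivity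
      have : ((n:ℝ)+1)^3 * coeff (n+1) (f*f) = (n + 1/2)^3 * (pf (1/2) n)^3 := by
        linear_combination h
      field_simp at this ⊢
      linear_combination this
  have := hrec n
  rw [coeff_mul] at this
  simpa [f] using this

lemma pf_sq_summable (y : ℝ) (hy : |y| < 1) : Summable fun n => ‖(pf (1/4) n)^2 * y ^ n‖ := by
  refine Summable.of_nonneg_of_le (fun _ => norm_nonneg _) (fun n => ?_)
    (summable_geometric_of_abs_lt_one (r := |y|) (by simpa using hy))
  rw [norm_mul, norm_pow, norm_pow, Real.norm_eq_abs, Real.norm_eq_abs,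
    abs_of_nonneg (pf_nonneg (by norm_num) n)]
  have := pf_le_one (a := 1/4) (by norm_num) (by norm_num) n
  have h0 := pf_nonneg (a := 1/4) (by norm_num) n
  exact mul_le_of_le_one_left (by positivity) (pow_le_one₀ h0 this)

lemma step1 (y : ℝ) (hy : |y| < 1) :
    ∑' n, (pf (1/2) n)^3 * y^n = (∑' n, (pf (1/4) n)^2 * y ^ n)^2 := by
  rw [sq, tsum_mul_tsum_eq_tsum_sum_antidiagonal_of_summable_norm (pf_sq_summable y hy)
    (pf_sq_summable y hy)]
  congr 1; ext n
  rw [← clausen, Finset.sum_mul]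
  refine Finset.sum_congr rfl fun kl hkl => ?_
  rw [← Finset.HasAntidiagonal.mem_antidiagonal.mp hkl, pow_add]; ring

lemma poch_add (a : ℝ) (k l : ℕ) : poch a (k + l) = poch a k * poch (a + k) l := by
  induction l with
  | zero => simp [poch_zero]
  | succ l ih =>
    rw [← Nat.add_assoc, poch_succ, ih, poch_succ]; push_cast; ring

lemma pf_mul (a : ℝ) (k l : ℕ) :
    pf a k * pf (a + k) l = pf a (k + l) * ((k + l).choose k : ℝ) := by
  have h := Nat.add_choose_mul_factorial_mul_factorial k l
  have h' : ((k+l).choose k : ℝ) * k.factorial * l.factorial = (k+l).factorial := by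
    rw [Nat.choose_symm_add]; exact_mod_cast h
  have h1 : (k.factorial : ℝ) ≠ 0 := by positivity
  have h2 : (l.factorial : ℝ) ≠ 0 := by positivity
  have h3 : ((k+l).factorial : ℝ) ≠ 0 := by positivity
  simp only [pf, poch_add]
  field_simp
  rw [← h']; ring

lemma vdm (n : ℕ) : ∑ kl ∈ Finset.HasAntidiagonal.antidiagonal n,
    (-1)^kl.1 * pf (1/4) kl.1 * (n.choose kl.1 : ℝ) = pf (3/4) n := by
  rw [pf_eq_choose, show (3/4 : ℝ) + n - 1 = -(1/4) + n by ring,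
    Ring.add_choose_eq n (Commute.all _ _)]
  refine Finset.sum_congr rfl fun kl hkl => ?_
  have h := Finset.HasAntidiagonal.mem_antidiagonal.mp hkl
  rw [pf_eq_choose', Ring.choose_natCast]
  congr 2
  rw [← h, Nat.choose_symm_add]

lemma pfaff : ∑' n, (pf (1/4) n)^2 * (-1/8 : ℝ)^n =
    (8/9 : ℝ)^(1/4 : ℝ) * ∑' n, pf (1/4) n * pf (3/4) n * (1/9 : ℝ)^n := by
  let F : ℕ × ℕ → ℝ := fun p =>
    (pf (1/4) p.1)^2 * (-1/9)^p.1 * (pf (1/4 + p.1) p.2 * (1/9)^p.2)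
  have hin : ∀ k : ℕ, HasSum (fun j => pf (1/4 + k) j * (1/9 : ℝ)^j)
      ((9/8)^(1/4 : ℝ) * (9/8 : ℝ)^k) := by
    intro k
    convert pf_hasSum (1/4 + k) (1/9) (by rw [abs_lt]; norm_num) using 1
    rw [show (1 - 1/9 : ℝ) = (9/8)⁻¹ by norm_num, Real.inv_rpow (by norm_num),
      Real.rpow_neg (by norm_num), inv_inv, Real.rpow_add (by norm_num), Real.rpow_natCast]
  have hsum : Summable F := by
    apply Summable.of_norm
    rw [summable_prod_of_nonneg (fun _ => norm_nonneg _)]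
    have e : ∀ k j : ℕ, ‖F (k, j)‖ = (pf (1/4) k)^2 * (1/9)^k * (pf (1/4 + k) j * (1/9 : ℝ)^j) := by
      intro k j
      simp only [F, norm_mul, norm_pow, Real.norm_eq_abs]
      rw [abs_of_nonneg (pf_nonneg (by norm_num) k),
        abs_of_nonneg (pf_nonneg (a := 1/4 + k) (by positivity) j)]
      norm_num [abs_of_pos]
    constructor
    · intro k
      simp only [e]
      exact (hin k).summable.mul_left _
    · simp only [e, tsum_mul_left, (hin _).tsum_eq]
      have := (pf_sq_summable (1/8) (by rw [abs_lt]; norm_num)).of_norm.mul_left ((9/8:ℝ)^(1/4 : ℝ))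
      refine this.congr fun k => ?_
      rw [show (1/8 : ℝ) = 1/9 * (9/8) by norm_num, mul_pow]; ring
  have h1 : ∑' p, F p = (9/8)^(1/4 : ℝ) * ∑' n, (pf (1/4) n)^2 * (-1/8 : ℝ)^n := by
    rw [hsum.tsum_prod, ← tsum_mul_left]
    congr 1; ext k
    simp only [F, tsum_mul_left, (hin _).tsum_eq]
    rw [show (-1/8 : ℝ) = -1/9 * (9/8) by norm_num, mul_pow]; ring
  have h2 : ∑' p, F p = ∑' n, pf (1/4) n * pf (3/4) n * (1/9 : ℝ)^n := by
    rw [← Finset.HasAntidiagonal.sigmaAntidiagonalEquivProd.tsum_eq F]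
    have hs2 : Summable fun c : (n : ℕ) × ↥(Finset.HasAntidiagonal.antidiagonal n) =>
        F (Finset.HasAntidiagonal.sigmaAntidiagonalEquivProd c) :=
      (Equiv.summable_iff Finset.HasAntidiagonal.sigmaAntidiagonalEquivProd).mpr hsum
    rw [Summable.tsum_sigma' (fun n => (hasSum_fintype _).summable) hs2]
    congr 1; ext n
    rw [tsum_fintype]
    rw [← vdm, Finset.mul_sum, Finset.sum_mul]
    rw [← Finset.sum_coe_sort (Finset.HasAntidiagonal.antidiagonal n)]
    refine Finset.sum_congr rfl fun kl _ => ?_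
    obtain ⟨⟨k, l⟩, hkl⟩ := kl
    have hn : k + l = n := Finset.HasAntidiagonal.mem_antidiagonal.mp hkl
    subst hn
    simp only [F, Finset.HasAntidiagonal.sigmaAntidiagonalEquivProd_apply]
    have := pf_mul (1/4) k l
    rw [pow_add, show (-1/9 : ℝ) = -1 * (1/9) by norm_num, mul_pow]
    linear_combination (pf (1/4) k * (-1)^k * (1/9)^k * (1/9)^l) * this
  rw [← h2, h1, ← mul_assoc, ← Real.mul_rpow (by norm_num) (by norm_num)]
  norm_num

lemma cos_even (m : ℕ) : ∫ x in (0:ℝ)..π, cos x ^ (2 * m) = π * pf (1/2) m := by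
  induction m with
  | zero => simp [pf_zero]
  | succ m ih =>
    rw [show 2 * (m+1) = 2 * m + 2 by ring, integral_cos_pow, ih, pf_succ]
    push_cast
    simp only [sin_pi, sin_zero]
    field_simp
    ring

lemma cos_odd (m : ℕ) : ∫ x in (0:ℝ)..π, cos x ^ (2 * m + 1) = 0 := by
  induction m with
  | zero => simp
  | succ m ih =>
    rw [show 2 * (m+1) + 1 = (2 * m + 1) + 2 by ring, integral_cos_pow, ih]
    simp

lemma pf_dup (m : ℕ) : pf (1/2) (2 * m) * pf (1/2) m = pf (1/4) m * pf (3/4) m := by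
  induction m with
  | zero => simp [pf_zero]
  | succ m ih =>
    rw [show 2 * (m+1) = 2 * m + 1 + 1 by ring, pf_succ, pf_succ, pf_succ _ m, pf_succ _ m, pf_succ _ m]
    push_cast
    have e1 : (2 * (m:ℝ) + 1 + 1) ≠ 0 := by positivity
    have e2 : (2 * (m:ℝ) + 1) ≠ 0 := by positivity
    have e3 : ((m:ℝ) + 1) ≠ 0 := by positivity
    have : (1/2 + 2*(m:ℝ)) / (2 * m + 1) * ((1/2 + (2*m+1)) / (2*m+1+1)) * ((1/2 + m)/(m+1))
      = (1/4 + m)/(m+1) * ((3/4+m)/(m+1)) := by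
      field_simp; ring
    linear_combination ((1/2 + 2*(m:ℝ)) / (2 * m + 1) * ((1/2 + (2*m+1)) / (2*m+1+1)) * ((1/2 + m)/(m+1))) * ih + pf (1/4) m * pf (3/4) m * this

lemma step3 : ∫ x in (0:ℝ)..π, (1 + cos x / 3) ^ (-(1/2) : ℝ) =
    π * ∑' n, pf (1/4) n * pf (3/4) n * (1/9 : ℝ)^n := by
  have hb : ∀ x : ℝ, |-(cos x / 3)| ≤ 1/3 := by
    intro x
    rw [abs_neg, abs_div, abs_of_pos (by norm_num : (0:ℝ) < 3)]
    linarith [abs_cos_le_one x]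
  have h := intervalIntegral.hasSum_integral_of_dominated_convergence (μ := MeasureTheory.volume)
    (a := 0) (b := π)
    (F := fun n x => pf (1/2) n * (-(cos x / 3))^n)
    (f := fun x => (1 + cos x / 3) ^ (-(1/2) : ℝ))
    (fun n _ => (1/3 : ℝ)^n)
    (fun n => by
      apply Continuous.aestronglyMeasurable
      fun_prop)
    (fun n => by
      refine Filter.Eventually.of_forall fun x _ => ?_
      rw [norm_mul, norm_pow, Real.norm_eq_abs, Real.norm_eq_abs,
        abs_of_nonneg (pf_nonneg (by norm_num) n)]
      calc _ ≤ 1 * (1/3 : ℝ)^n := by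
            gcongr
            · exact pf_le_one (by norm_num) (by norm_num) n
            · exact hb x
        _ = _ := by ring)
    (Filter.Eventually.of_forall fun x _ =>
      summable_geometric_of_abs_lt_one (by rw [abs_lt]; norm_num))
    (by simp)
    (Filter.Eventually.of_forall fun x _ => by
      have := pf_hasSum (1/2) (-(cos x / 3)) (lt_of_le_of_lt (hb x) (by norm_num))
      simpa [sub_neg_eq_add] using this)
  have e : ∀ n : ℕ, ∫ x in (0:ℝ)..π, pf (1/2) n * (-(cos x / 3))^n
      = pf (1/2) n * (-1/3)^n * ∫ x in (0:ℝ)..π, cos x ^ n := by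
    intro n
    rw [← intervalIntegral.integral_const_mul]
    congr 1; ext x
    rw [show -(cos x / 3) = (-1/3) * cos x by ring, mul_pow]; ring
  simp only [e] at h
  rw [← h.tsum_eq, ← tsum_even_add_odd]
  · have hodd : ∀ k : ℕ, pf (1/2) (2*k+1) * (-1/3 : ℝ)^(2*k+1) * ∫ x in (0:ℝ)..π, cos x ^ (2*k+1) = 0 := by
      intro k; rw [cos_odd]; ring
    simp only [hodd, tsum_zero, add_zero, cos_even]
    rw [← tsum_mul_left]
    congr 1; ext k
    rw [← pf_dup, pow_mul]; norm_num; ring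
  · exact h.summable.comp_injective (i := fun k => 2 * k) (fun a b hab => by simpa using hab)
  · exact h.summable.comp_injective (i := fun k => 2 * k + 1) (fun a b hab => by simpa using hab)

lemma image_cos4 : (fun x : ℝ => cos (x/2) ^ 4) '' Set.Ioo 0 π = Set.Ioo 0 1 := by
  ext s
  constructor
  · rintro ⟨x, ⟨h0, h1⟩, rfl⟩
    have hc : 0 < cos (x/2) := cos_pos_of_mem_Ioo ⟨by linarith [pi_pos], by linarith⟩
    have hs : 0 < sin (x/2) := sin_pos_of_pos_of_lt_pi (by linarith) (by linarith)
    have := sin_sq_add_cos_sq (x/2)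
    have hc1 : cos (x/2) < 1 := by nlinarith
    exact ⟨by positivity, pow_lt_one₀ hc.le hc1 (by norm_num)⟩
  · rintro ⟨h0, h1⟩
    have hr0 : 0 < s ^ (1/4 : ℝ) := by positivity
    have hr1 : s ^ (1/4 : ℝ) < 1 := Real.rpow_lt_one h0.le h1 (by norm_num)
    refine ⟨2 * arccos (s ^ (1/4 : ℝ)), ⟨?_, ?_⟩, ?_⟩
    · have := arccos_pos.mpr hr1; linarith
    · have := arccos_lt_pi_div_two.mpr hr0; linarith
    · simp only
      rw [mul_div_cancel_left₀ _ (by norm_num), cos_arccos (by linarith) hr1.le,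
        ← Real.rpow_natCast, ← Real.rpow_mul h0.le]
      norm_num

lemma beta_real : ∫ s in Set.Ioo (0:ℝ) 1, s ^ (-(3/4) : ℝ) * (1 - s) ^ (-(1/2) : ℝ) =
    Gamma (1/4) * √π / Gamma (3/4) := by
  have h := Complex.betaIntegral_eq_Gamma_mul_div (1/4 : ℝ) (1/2 : ℝ) (by simp) (by simp)
  rw [Complex.betaIntegral, ← Complex.ofReal_add, Complex.Gamma_ofReal, Complex.Gamma_ofReal,
    Complex.Gamma_ofReal] at h
  have e : ∫ x in (0:ℝ)..1, (x:ℂ) ^ (((1/4 : ℝ) : ℂ) - 1) * (1 - (x:ℂ)) ^ (((1/2 : ℝ):ℂ) - 1)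
      = ((∫ s in (0:ℝ)..1, s ^ (-(3/4) : ℝ) * (1 - s) ^ (-(1/2) : ℝ) : ℝ) : ℂ) := by
    rw [← intervalIntegral.integral_ofReal]
    refine intervalIntegral.integral_congr fun x hx => ?_
    rw [Set.uIcc_of_le (by norm_num)] at hx
    have h1 : 0 ≤ 1 - x := by linarith [hx.2]
    simp only [Complex.ofReal_mul, Complex.ofReal_cpow hx.1, Complex.ofReal_cpow h1]
    push_cast
    norm_num
  rw [e] at h
  rw [← MeasureTheory.integral_Ioc_eq_integral_Ioo, ← intervalIntegral.integral_of_le (by norm_num)]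
  have h' : (∫ s in (0:ℝ)..1, s ^ (-(3/4) : ℝ) * (1 - s) ^ (-(1/2) : ℝ)) =
    Gamma (1/4) * Gamma (1/2) / Gamma (1/4 + 1/2) := by exact_mod_cast h
  rw [h', Real.Gamma_one_half_eq]
  norm_num

lemma step4 : ∫ x in (0:ℝ)..π, (1 + cos x / 3) ^ (-(1/2) : ℝ) =
    √(3/8) * (Gamma (1/4) * √π / Gamma (3/4)) := by
  rw [← beta_real, ← image_cos4,
    MeasureTheory.integral_image_eq_integral_abs_deriv_smul
    (f' := fun x => - (2 * cos (x/2) ^ 3 * sin (x/2))) measurableSet_Ioo,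
    intervalIntegral.integral_of_le pi_pos.le, MeasureTheory.integral_Ioc_eq_integral_Ioo,
    ← MeasureTheory.integral_const_mul]
  · refine MeasureTheory.setIntegral_congr_fun measurableSet_Ioo fun x hx => ?_
    obtain ⟨h0, h1⟩ := hx
    have hc : 0 < cos (x/2) := cos_pos_of_mem_Ioo ⟨by linarith [pi_pos], by linarith⟩
    have hs : 0 < sin (x/2) := sin_pos_of_pos_of_lt_pi (by linarith) (by linarith)
    have hsc := sin_sq_add_cos_sq (x/2)
    have hcx : cos x = 2 * cos (x/2)^2 - 1 := by rw [← cos_two_mul]; ring_nf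
    simp only [smul_eq_mul]
    rw [abs_neg, abs_of_pos (by positivity)]
    have e1 : (cos (x/2)^4) ^ (-(3/4) : ℝ) = (cos (x/2)^3)⁻¹ := by
      rw [← Real.rpow_natCast, ← Real.rpow_mul hc.le, ← Real.rpow_natCast, ← Real.rpow_neg hc.le]
      norm_num
    have e2 : (1 - cos (x/2)^4) ^ (-(1/2) : ℝ) = (sin (x/2) * √(1 + cos (x/2)^2))⁻¹ := by
      rw [Real.rpow_neg (by nlinarith [sq_nonneg (cos (x/2))]), ← Real.sqrt_eq_rpow,
        show 1 - cos (x/2)^4 = sin (x/2)^2 * (1 + cos (x/2)^2) by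
          linear_combination -(1 + cos (x/2)^2) * hsc,
        Real.sqrt_mul (by positivity), Real.sqrt_sq hs.le]
    have e3 : (1 + cos x / 3) ^ (-(1/2) : ℝ) = (√(2/3) * √(1 + cos (x/2)^2))⁻¹ := by
      rw [hcx, Real.rpow_neg (by nlinarith [sq_nonneg (cos (x/2))]), ← Real.sqrt_eq_rpow,
        ← Real.sqrt_mul (by norm_num)]
      congr 2; ring
    rw [e1, e2, e3]
    have e4 : √(3/8) * 2 * √(2/3) = 1 := by
      rw [mul_right_comm, ← Real.sqrt_mul (by norm_num), show (3/8 * (2/3) : ℝ) = (1/2)^2 by norm_num,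
        Real.sqrt_sq (by norm_num)]; norm_num
    have : 0 < √(1 + cos (x/2)^2) := Real.sqrt_pos.mpr (by positivity)
    have : 0 < √(2/3 : ℝ) := Real.sqrt_pos.mpr (by positivity)
    field_simp
    linear_combination -e4
  · intro x _
    apply HasDerivAt.hasDerivWithinAt
    have h := (((hasDerivAt_id x).div_const 2).cos).pow 4
    refine HasDerivAt.congr_deriv h ?_
    simp
    ring
  · intro x hx y hy hxy
    have hc : 0 < cos (x/2) := cos_pos_of_mem_Ioo ⟨by linarith [pi_pos, hx.1], by linarith [hx.2]⟩
    have hc' : 0 < cos (y/2) := cos_pos_of_mem_Ioo ⟨by linarith [pi_pos, hy.1], by linarith [hy.2]⟩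
    have := (pow_left_inj₀ hc.le hc'.le (by norm_num)).mp hxy
    have := injOn_cos ⟨by linarith [hx.1], by linarith [hx.2, pi_pos]⟩
      ⟨by linarith [hy.1], by linarith [hy.2, pi_pos]⟩ this
    linarith

lemma prod_trip (s : ℝ) (N : ℕ) : ∏ j ∈ Finset.range (3 * N), (3 * s + j) =
    3 ^ (3 * N) * ((∏ j ∈ Finset.range N, (s + j)) * (∏ j ∈ Finset.range N, (s + 1/3 + j)) *
      (∏ j ∈ Finset.range N, (s + 2/3 + j))) := by
  induction N with
  | zero => simp
  | succ N ih =>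
    rw [show 3 * (N+1) = 3 * N + 1 + 1 + 1 by ring]
    simp only [Finset.prod_range_succ, ih]
    push_cast
    ring

noncomputable def Dseq (n : ℕ) : ℝ :=
  n * (n.factorial : ℝ)^3 * 3 ^ (3 * n + 3) / ((3 * n + 2).factorial : ℝ)

lemma gammaSeq_trip (s : ℝ) (hs : 0 < s) (n : ℕ) (hn : 0 < n) :
    GammaSeq s n * GammaSeq (s + 1/3) n * GammaSeq (s + 2/3) n * (3 + 2 / (n:ℝ)) ^ (3 * s) =
      Dseq n * GammaSeq (3 * s) (3 * n + 2) := by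
  have hn' : (0:ℝ) < n := by exact_mod_cast hn
  have hp := prod_trip s (n+1)
  rw [show 3 * (n+1) = 3 * n + 2 + 1 by ring] at hp
  have p1 : 0 < ∏ j ∈ Finset.range (n+1), (s + j) := Finset.prod_pos fun j _ => by positivity
  have p2 : 0 < ∏ j ∈ Finset.range (n+1), (s + 1/3 + j) := Finset.prod_pos fun j _ => by positivity
  have p3 : 0 < ∏ j ∈ Finset.range (n+1), (s + 2/3 + j) := Finset.prod_pos fun j _ => by positivity
  simp only [GammaSeq, Dseq]
  rw [hp]
  have hf : ((3 * n + 2).factorial : ℝ) ≠ 0 := by positivity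
  have e1 : ((3 * n + 2 : ℕ) : ℝ) ^ (3 * s) = (n:ℝ)^(3*s) * (3 + 2 / (n:ℝ)) ^ (3 * s) := by
    rw [← Real.mul_rpow hn'.le (by positivity)]
    congr 1
    push_cast
    field_simp
  have e2 : (n:ℝ)^s * (n:ℝ)^(s+1/3) * (n:ℝ)^(s+2/3) = (n:ℝ)^(3*s) * n := by
    rw [← Real.rpow_add hn', ← Real.rpow_add hn']
    nth_rewrite 3 [← Real.rpow_one (n:ℝ)]
    rw [← Real.rpow_add hn']
    congr 1; ring
  rw [e1]
  generalize (3 + 2 / (n:ℝ)) ^ (3 * s) = w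
  generalize (n:ℝ)^s = w1 at *
  generalize (n:ℝ)^(s+1/3) = w2 at *
  generalize (n:ℝ)^(s+2/3) = w3 at *
  generalize (n:ℝ)^(3*s) = w4 at *
  generalize ∏ j ∈ Finset.range (n+1), (s + j) = q1 at *
  generalize ∏ j ∈ Finset.range (n+1), (s + 1/3 + j) = q2 at *
  generalize ∏ j ∈ Finset.range (n+1), (s + 2/3 + j) = q3 at *
  field_simp
  linear_combination w * e2

lemma Dseq_tendsto (s : ℝ) (hs : 0 < s) : Filter.Tendsto Dseq Filter.atTop
    (nhds (Gamma s * Gamma (s + 1/3) * Gamma (s + 2/3) * 3 ^ (3 * s) / Gamma (3 * s))) := by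
  have h3 : Filter.Tendsto (fun n : ℕ => (3 + 2 / (n:ℝ)) ^ (3 * s)) Filter.atTop (nhds (3 ^ (3*s))) := by
    have : Filter.Tendsto (fun n : ℕ => (3 + 2 / (n:ℝ))) Filter.atTop (nhds (3 + 0)) :=
      tendsto_const_nhds.add (tendsto_const_div_atTop_nhds_zero_nat 2)
    rw [add_zero] at this
    exact this.rpow_const (Or.inl (by norm_num))
  have hg : Filter.Tendsto (fun n : ℕ => GammaSeq (3 * s) (3 * n + 2)) Filter.atTop (nhds (Gamma (3*s))) := by
    refine (GammaSeq_tendsto_Gamma (3 * s)).comp ?_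
    exact Filter.tendsto_atTop_mono (fun n => by simp only [id]; omega) Filter.tendsto_id
  have hG : Gamma (3*s) ≠ 0 := (Gamma_pos_of_pos (by positivity)).ne'
  have h := (((((GammaSeq_tendsto_Gamma s).mul (GammaSeq_tendsto_Gamma (s + 1/3))).mul
    (GammaSeq_tendsto_Gamma (s + 2/3))).mul h3).div hg hG)
  refine h.congr' ?_
  filter_upwards [Filter.eventually_gt_atTop 0, hg.eventually_ne hG] with n hn hne
  have := gammaSeq_trip s hs n hn
  simp only [Pi.div_apply]
  rw [this, mul_div_cancel_right₀ _ hne]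

lemma gamma_trip : Gamma (1/4) * (Gamma (7/12) * Gamma (11/12)) * (3:ℝ) ^ (3/4 : ℝ) =
    2 * π * √3 * Gamma (3/4) := by
  have h := tendsto_nhds_unique (Dseq_tendsto (1/4) (by norm_num)) (Dseq_tendsto (1/3) (by norm_num))
  have r := Real.Gamma_mul_Gamma_one_sub (1/3)
  rw [show π * (1/3) = π/3 by ring, sin_pi_div_three] at r
  norm_num at h r
  rw [r] at h
  have h34 : Gamma (3/4 : ℝ) ≠ 0 := (Gamma_pos_of_pos (by norm_num)).ne'
  have s3 : √3 * √3 = 3 := Real.mul_self_sqrt (by norm_num)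
  have s3' : √3 ≠ 0 := by positivity
  rw [div_eq_iff h34] at h
  rw [← mul_assoc, h]
  field_simp
  nlinarith

theorem stmt_11 :
    ∑' n : ℕ, (poch (1/2) n * poch (1/2) n * poch (1/2) n) / (poch 1 n)^3 * ((1:ℝ)) * ((-1:ℝ)/8)^n = π * Real.sqrt 6 / (3 * (Real.Gamma (7/12))^2 * (Real.Gamma (11/12))^2) := by
  have h0 : ∀ n : ℕ, (poch (1/2) n * poch (1/2) n * poch (1/2) n) / (poch 1 n)^3 * ((1:ℝ)) *
      ((-1:ℝ)/8)^n = (pf (1/2) n)^3 * (-1/8)^n := by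
    intro n; rw [poch_one, pf]; ring
  simp only [h0]
  rw [step1 _ (by rw [abs_lt]; norm_num), pfaff]
  have h34 := step3.symm.trans step4
  have ht := gamma_trip
  generalize ∑' n, pf (1/4) n * pf (3/4) n * (1/9 : ℝ)^n = P at *
  have g1 : 0 < Gamma (1/4 : ℝ) := Gamma_pos_of_pos (by norm_num)
  have g2 : 0 < Gamma (3/4 : ℝ) := Gamma_pos_of_pos (by norm_num)
  have g3 : 0 < Gamma (7/12 : ℝ) := Gamma_pos_of_pos (by norm_num)
  have g4 : 0 < Gamma (11/12 : ℝ) := Gamma_pos_of_pos (by norm_num)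
  generalize Gamma (1/4 : ℝ) = a at *
  generalize Gamma (3/4 : ℝ) = b at *
  have hp := pi_pos
  have e1 : ((8/9 : ℝ)^(1/4 : ℝ))^2 = 2 * √2 / 3 := by
    rw [← Real.rpow_natCast, ← Real.rpow_mul (by norm_num),
      show (1/4 * ((2:ℕ):ℝ) : ℝ) = 1/2 by norm_num, ← Real.sqrt_eq_rpow, Real.sqrt_div (by norm_num),
      show (8:ℝ) = 2^2 * 2 by norm_num, Real.sqrt_mul (by norm_num), Real.sqrt_sq (by norm_num),
      show (9:ℝ) = 3^2 by norm_num, Real.sqrt_sq (by norm_num)]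
  have e2 : ((3:ℝ)^(3/4 : ℝ))^2 = 3 * √3 := by
    rw [← Real.rpow_natCast, ← Real.rpow_mul (by norm_num),
      show (3/4 * ((2:ℕ):ℝ) : ℝ) = 1 + 1/2 by norm_num, Real.rpow_add (by norm_num), Real.rpow_one,
      ← Real.sqrt_eq_rpow]
  have e3 : (π * P)^2 = 3/8 * (a^2 * π / b^2) := by
    rw [h34, mul_pow, div_pow, mul_pow, Real.sq_sqrt (by norm_num), Real.sq_sqrt hp.le]
  have e4 : a^2 * (Gamma (7/12) * Gamma (11/12))^2 * (3 * √3) = 12 * π^2 * b^2 := by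
    rw [← e2, ← mul_pow, ← mul_pow, ht, mul_pow, mul_pow, mul_pow, Real.sq_sqrt (by norm_num)]
    ring
  have e6 : √6 = √2 * √3 := by rw [← Real.sqrt_mul (by norm_num)]; norm_num
  have s3 : √3 * √3 = 3 := Real.mul_self_sqrt (by norm_num)
  have s3p : 0 < √3 := by positivity
  have e5 : P^2 = 3/8 * a^2 / (π * b^2) := by
    field_simp at e3 ⊢
    linear_combination e3
  rw [mul_pow, e1, e5, e6]
  rw [show 3 * Gamma (7/12)^2 * Gamma (11/12)^2 = 3 * (Gamma (7/12) * Gamma (11/12))^2 by ring]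
  have gp : 0 < Gamma (7/12) * Gamma (11/12) := by positivity
  generalize Gamma (7/12) * Gamma (11/12) = g at *
  have e7 : g^2 = 12 * π^2 * b^2 / (a^2 * (3 * √3)) := by
    field_simp
    linear_combination e4
  rw [e7]
  field_simp
  nlinarith
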